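/- arXiv:2405.11593 — 2 statements merged into one kernel-verified Lean document; each statement's English description precedes it below -/
import Mathlib

section
/- Let x̄ be a weak local minimizer of problem (P). Then there exists a neighborhood N of x̄ such that F(x) ≥ F(x̄) = 0 for all x ∈ N, where F(x) := sup{ λ·(f(x) − f(x̄)) + μ·g(x) : (λ,μ) ∈ Λ }. -/
open Filter Topology Pointwise

noncomputable section

/-- Euclidean dot product on `Fin n → ℝ`. -/
def dotp {n : ℕ} (a b : Fin n → ℝ) : ℝ := ∑ i, a i * b i

/-- Positive polar cone `C* = {l | l·x ≥ 0 for all x ∈ C}`. -/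
def polarCone {n : ℕ} (C : Set (Fin n → ℝ)) : Set (Fin n → ℝ) :=
  {l | ∀ x ∈ C, 0 ≤ dotp l x}

/-- A closed convex pointed cone with vertex at the origin. -/
def IsClosedConvexPointedCone {n : ℕ} (C : Set (Fin n → ℝ)) : Prop :=
  IsClosed C ∧ Convex ℝ C ∧ (0 : Fin n → ℝ) ∈ C ∧
    (∀ c : ℝ, 0 ≤ c → ∀ x ∈ C, c • x ∈ C) ∧ C ∩ (-C) ⊆ {0}

/-- The set Λ of normalized multiplier pairs. -/
def LambdaSet {n m : ℕ} (C : Set (Fin n → ℝ)) (K : Set (Fin m → ℝ)) :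
    Set ((Fin n → ℝ) × (Fin m → ℝ)) :=
  {p | p.1 ∈ polarCone C ∧ p.2 ∈ polarCone K ∧
    (∑ i, |p.1 i|) + (∑ j, |p.2 j|) = 1}

/-- `x̄` is a weak local minimizer of problem (P): no feasible point near `x̄`
has `f x ∈ f x̄ − int C`. -/
def WeakLocalMin {s n m : ℕ} (C : Set (Fin n → ℝ)) (K : Set (Fin m → ℝ))
    (X : Set (Fin s → ℝ)) (f : (Fin s → ℝ) → (Fin n → ℝ))
    (g : (Fin s → ℝ) → (Fin m → ℝ)) (xbar : Fin s → ℝ) : Prop :=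
  ∃ N ∈ 𝓝 xbar, ∀ x ∈ N, x ∈ X → g x ∈ -K →
    f x ∉ ({f xbar} : Set (Fin n → ℝ)) - interior C

/-- The auxiliary function `F(x) = sup{λ·(f x − f x̄) + μ·g x : (λ,μ) ∈ Λ}`. -/
def Ffun {s n m : ℕ} (C : Set (Fin n → ℝ)) (K : Set (Fin m → ℝ))
    (f : (Fin s → ℝ) → (Fin n → ℝ)) (g : (Fin s → ℝ) → (Fin m → ℝ))
    (xbar x : Fin s → ℝ) : ℝ :=
  sSup ((fun p => dotp p.1 (f x - f xbar) + dotp p.2 (g x)) '' LambdaSet C K)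

theorem dotp_smul_left {n : ℕ} (c : ℝ) (a b : Fin n → ℝ) : dotp (c • a) b = c * dotp a b := by
  simp [dotp, Finset.mul_sum, mul_assoc]

theorem dotp_zero_left {n : ℕ} (b : Fin n → ℝ) : dotp 0 b = 0 := by
  simp [dotp]

theorem dotp_zero_right {n : ℕ} (a : Fin n → ℝ) : dotp a 0 = 0 := by
  simp [dotp]

theorem dotp_neg_left {n : ℕ} (a b : Fin n → ℝ) : dotp (-a) b = -dotp a b := by
  simp [dotp]

theorem dotp_neg_right {n : ℕ} (a b : Fin n → ℝ) : dotp a (-b) = -dotp a b := by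
  simp [dotp]

theorem dotp_le_sum_abs_mul_sum_abs {n : ℕ} (a b : Fin n → ℝ) :
    dotp a b ≤ (∑ i, |a i|) * ∑ i, |b i| := by
  rw [dotp, Finset.sum_mul]
  refine Finset.sum_le_sum fun i _ => ?_
  calc a i * b i ≤ |a i| * |b i| := by rw [← abs_mul]; exact le_abs_self _
    _ ≤ |a i| * ∑ j, |b j| := by
      gcongr
      exact Finset.single_le_sum (f := fun j => |b j|) (fun j _ => abs_nonneg _)
        (Finset.mem_univ i)

/-- Every continuous linear functional on `Fin n → ℝ` is given by a dot product. -/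
theorem exists_eq_dotp {n : ℕ} (φ : (Fin n → ℝ) →L[ℝ] ℝ) :
    ∃ l : Fin n → ℝ, ∀ y, φ y = dotp l y := by
  refine ⟨fun i => φ (Pi.single i 1), fun y => ?_⟩
  conv_lhs => rw [pi_eq_sum_univ' y]
  simp [dotp, map_sum, mul_comm]

theorem zero_mem_polarCone {n : ℕ} (C : Set (Fin n → ℝ)) : (0 : Fin n → ℝ) ∈ polarCone C :=
  fun x _ => (dotp_zero_left x).ge

/-- The negative of a functional bounded above on a cone lies in the polar cone. -/
theorem neg_mem_polarCone_of_bounded {n : ℕ} {C : Set (Fin n → ℝ)}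
    (hC : IsClosedConvexPointedCone C) {l : Fin n → ℝ} {u : ℝ}
    (h : ∀ a ∈ C, dotp l a ≤ u) : -l ∈ polarCone C := by
  intro a ha
  rw [dotp_neg_left]
  by_contra! hlt
  have hpos : 0 < dotp l a := by linarith
  have := h _ (hC.2.2.2.1 ((|u| + 1) / dotp l a) (by positivity) a ha)
  have heq : dotp l (((|u| + 1) / dotp l a) • a) = |u| + 1 := by
    have : ∀ c : ℝ, dotp l (c • a) = c * dotp l a := fun c => by
      simp [dotp, Finset.mul_sum, mul_left_comm]
    rw [this, div_mul_cancel₀ _ hpos.ne']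
  linarith [le_abs_self u]

theorem exists_polarCone_of_notMem_interior {n : ℕ} {C : Set (Fin n → ℝ)}
    (hC : IsClosedConvexPointedCone C) (hint : (interior C).Nonempty) {y : Fin n → ℝ}
    (hy : -y ∉ interior C) : ∃ l ∈ polarCone C, l ≠ 0 ∧ 0 ≤ dotp l y := by
  obtain ⟨φ, hφ⟩ := geometric_hahn_banach_open_point hC.2.1.interior isOpen_interior hy
  obtain ⟨l, hl⟩ := exists_eq_dotp φ
  have hle : ∀ a ∈ C, φ a ≤ φ (-y) := by
    intro a ha
    have hcl : a ∈ closure (interior C) := by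
      rw [hC.2.1.closure_interior_eq_closure_of_nonempty_interior hint]
      exact subset_closure ha
    exact closure_minimal (fun b hb => (hφ b hb).le)
      (isClosed_le φ.continuous continuous_const) hcl
  refine ⟨-l, neg_mem_polarCone_of_bounded hC fun a ha => hl a ▸ hle a ha, ?_, ?_⟩
  · intro h0
    obtain ⟨a, ha⟩ := hint
    have := hφ a ha
    simp [hl, neg_eq_zero.mp h0, dotp_zero_left] at this
  · have := hle 0 hC.2.2.1
    rwa [map_zero, hl, dotp_neg_right, ← dotp_neg_left] at this

theorem exists_polarCone_of_notMem {n : ℕ} {K : Set (Fin n → ℝ)}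
    (hK : IsClosedConvexPointedCone K) {z : Fin n → ℝ}
    (hz : -z ∉ K) : ∃ l ∈ polarCone K, 0 < dotp l z := by
  obtain ⟨φ, u, hφ, hu⟩ := geometric_hahn_banach_closed_point hK.2.1 hK.1 hz
  obtain ⟨l, hl⟩ := exists_eq_dotp φ
  refine ⟨-l, neg_mem_polarCone_of_bounded hK fun a ha => hl a ▸ (hφ a ha).le, ?_⟩
  have h0 := hφ 0 hK.2.2.1
  rw [map_zero] at h0
  rw [hl, dotp_neg_right, ← dotp_neg_left] at hu
  linarith

theorem smul_mem_polarCone {n : ℕ} {C : Set (Fin n → ℝ)} {c : ℝ} (hc : 0 ≤ c)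
    {l : Fin n → ℝ} (hl : l ∈ polarCone C) : c • l ∈ polarCone C := fun x hx => by
  rw [dotp_smul_left]
  exact mul_nonneg hc (hl x hx)

theorem sum_abs_pos {n : ℕ} {l : Fin n → ℝ} (hl : l ≠ 0) : 0 < ∑ i, |l i| := by
  obtain ⟨i, hi⟩ := Function.ne_iff.mp hl
  exact Finset.sum_pos' (fun j _ => abs_nonneg _) ⟨i, Finset.mem_univ i, abs_pos.mpr hi⟩

theorem sum_abs_inv_smul {n : ℕ} {l : Fin n → ℝ} (hl : l ≠ 0) :
    ∑ i, |((∑ j, |l j|)⁻¹ • l) i| = 1 := by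
  have h := sum_abs_pos hl
  simp only [Pi.smul_apply, smul_eq_mul, abs_mul, ← Finset.mul_sum]
  rw [abs_of_pos (inv_pos.mpr h), inv_mul_cancel₀ h.ne']

theorem bddAbove_image_LambdaSet {n m : ℕ} (C : Set (Fin n → ℝ)) (K : Set (Fin m → ℝ))
    (y : Fin n → ℝ) (z : Fin m → ℝ) :
    BddAbove ((fun p => dotp p.1 y + dotp p.2 z) '' LambdaSet C K) := by
  refine ⟨(∑ i, |y i|) + ∑ j, |z j|, ?_⟩
  rintro _ ⟨p, ⟨-, -, hp⟩, rfl⟩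
  have h1 := dotp_le_sum_abs_mul_sum_abs p.1 y
  have h2 := dotp_le_sum_abs_mul_sum_abs p.2 z
  have hp1 : 0 ≤ ∑ i, |p.1 i| := by positivity
  have hp2 : 0 ≤ ∑ j, |p.2 j| := by positivity
  have hy : 0 ≤ ∑ i, |y i| := by positivity
  have hz : 0 ≤ ∑ j, |z j| := by positivity
  dsimp only
  nlinarith

theorem sSup_nonneg_of_polarCone_left {n m : ℕ} {C : Set (Fin n → ℝ)} (K : Set (Fin m → ℝ))
    {y : Fin n → ℝ} (z : Fin m → ℝ) {l : Fin n → ℝ} (hl : l ∈ polarCone C) (h0 : l ≠ 0)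
    (hy : 0 ≤ dotp l y) :
    0 ≤ sSup ((fun p => dotp p.1 y + dotp p.2 z) '' LambdaSet C K) := by
  have hc := inv_nonneg.mpr (sum_abs_pos h0).le
  refine le_csSup_of_le (bddAbove_image_LambdaSet C K y z)
    ⟨((∑ j, |l j|)⁻¹ • l, 0), ⟨smul_mem_polarCone hc hl, zero_mem_polarCone K, ?_⟩, rfl⟩ ?_
  · simpa only [Pi.zero_apply, abs_zero, Finset.sum_const_zero, add_zero] using
      sum_abs_inv_smul h0
  · simpa only [dotp_zero_left, add_zero, dotp_smul_left] using mul_nonneg hc hy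

theorem sSup_nonneg_of_polarCone_right {n m : ℕ} (C : Set (Fin n → ℝ)) {K : Set (Fin m → ℝ)}
    (y : Fin n → ℝ) {z : Fin m → ℝ} {l : Fin m → ℝ} (hl : l ∈ polarCone K) (h0 : l ≠ 0)
    (hz : 0 ≤ dotp l z) :
    0 ≤ sSup ((fun p => dotp p.1 y + dotp p.2 z) '' LambdaSet C K) := by
  have hc := inv_nonneg.mpr (sum_abs_pos h0).le
  refine le_csSup_of_le (bddAbove_image_LambdaSet C K y z)
    ⟨(0, (∑ j, |l j|)⁻¹ • l), ⟨zero_mem_polarCone C, smul_mem_polarCone hc hl, ?_⟩, rfl⟩ ?_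
  · simpa only [Pi.zero_apply, abs_zero, Finset.sum_const_zero, zero_add] using
      sum_abs_inv_smul h0
  · simpa only [dotp_zero_left, zero_add, dotp_smul_left] using mul_nonneg hc hz

/-- If `x̄` is a weak local minimizer of (P), then there is a neighborhood `N` of `x̄`
with `F(x) ≥ F(x̄) = 0` for all `x ∈ N`. -/
theorem stmt_0 {s n m : ℕ}
    (C : Set (Fin n → ℝ)) (K : Set (Fin m → ℝ))
    (hC : IsClosedConvexPointedCone C) (hK : IsClosedConvexPointedCone K)
    (hCint : (interior C).Nonempty)
    (X : Set (Fin s → ℝ)) (hX : IsOpen X)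
    (f : (Fin s → ℝ) → (Fin n → ℝ)) (g : (Fin s → ℝ) → (Fin m → ℝ))
    (xbar : Fin s → ℝ) (hxX : xbar ∈ X) (hxfeas : g xbar ∈ -K)
    (hmin : WeakLocalMin C K X f g xbar) :
    Ffun C K f g xbar xbar = 0 ∧
      ∃ N ∈ 𝓝 xbar, ∀ x ∈ N, Ffun C K f g xbar x ≥ Ffun C K f g xbar xbar := by
  obtain ⟨N, hN, hmin⟩ := hmin
  have key : ∀ x ∈ N ∩ X, 0 ≤ Ffun C K f g xbar x := by
    rintro x ⟨hxN, hx⟩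
    by_cases hg : g x ∈ -K
    · have hy : -(f x - f xbar) ∉ interior C := fun h =>
        hmin x hxN hx hg ⟨f xbar, rfl, _, h, by simp⟩
      obtain ⟨l, hl, h0, hly⟩ := exists_polarCone_of_notMem_interior hC hCint hy
      exact sSup_nonneg_of_polarCone_left K (g x) hl h0 hly
    · obtain ⟨l, hl, hlz⟩ := exists_polarCone_of_notMem hK hg
      refine sSup_nonneg_of_polarCone_right C _ hl ?_ hlz.le
      rintro rfl
      exact hlz.ne' (dotp_zero_left _)
  have hzero : Ffun C K f g xbar xbar = 0 := by
    refine le_antisymm (Real.sSup_nonpos ?_) (key xbar ⟨mem_of_mem_nhds hN, hxX⟩)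
    rintro _ ⟨p, ⟨-, hp, -⟩, rfl⟩
    have := hp _ hxfeas
    rw [dotp_neg_right] at this
    simpa [dotp_zero_right] using this
  refine ⟨hzero, N ∩ X, inter_mem hN (hX.mem_nhds hxX), fun x hx => ?_⟩
  rw [hzero]
  exact key x hx
end
end

section
/- Let x̄ be a weak local minimizer of problem (P) with f and g Fréchet differentiable at x̄. If the cone K has nonempty interior and g(x̄) ∈ −int(K), then there exist Fritz John multipliers with μ = 0: i.e., there exists λ ∈ C*, λ ≠ 0, with λ·∇f(x̄) = 0. -/
open Filter Topology Pointwise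

noncomputable section

/-- Every continuous linear functional on `Fin n → ℝ` is given by a dot product. -/
theorem exists_dotp_eq {n : ℕ} (φ : (Fin n → ℝ) →L[ℝ] ℝ) :
    ∃ l : Fin n → ℝ, ∀ x, dotp l x = φ x := by
  refine ⟨fun i => φ (Pi.single i 1), fun x => ?_⟩
  have h := φ.toLinearMap.pi_apply_eq_sum_univ x
  simp only [ContinuousLinearMap.coe_coe, smul_eq_mul] at h
  rw [h, dotp]
  refine Finset.sum_congr rfl fun i _ => ?_
  rw [mul_comm]
  congr 2
  ext j
  simp [Pi.single_apply, eq_comm]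

/-- The interior of a set stable under positive dilations is stable under positive dilations. -/
theorem smul_mem_interior_of_smul_mem {E : Type*} [AddCommGroup E] [Module ℝ E]
    [TopologicalSpace E] [ContinuousConstSMul ℝ E] {C : Set E}
    (hC : ∀ c : ℝ, 0 ≤ c → ∀ x ∈ C, c • x ∈ C) {t : ℝ} (ht : 0 < t) {x : E}
    (hx : x ∈ interior C) : t • x ∈ interior C := by
  have hsub : t • C ⊆ C := Set.smul_set_subset_iff.2 fun y hy => hC t ht.le y hy
  refine interior_mono hsub ?_
  rw [interior_smul₀ ht.ne']
  exact Set.smul_mem_smul_set hx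

/-- A subspace disjoint from the interior of a convex set is annihilated by a continuous linear
functional that is negative on that interior. -/
theorem exists_clm_neg_interior_of_disjoint {E : Type*} [NormedAddCommGroup E]
    [NormedSpace ℝ E] {C : Set E} (hconv : Convex ℝ C) (V : Submodule ℝ E)
    (hdisj : Disjoint (interior C) (V : Set E)) :
    ∃ φ : E →L[ℝ] ℝ, (∀ x ∈ interior C, φ x < 0) ∧ ∀ v ∈ V, φ v = 0 := by
  obtain ⟨φ, a, hlt, hle⟩ :=
    geometric_hahn_banach_open hconv.interior isOpen_interior V.convex hdisj
  have ha : a ≤ 0 := by simpa using hle 0 V.zero_mem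
  refine ⟨φ, fun x hx => (hlt x hx).trans_le ha, fun v hv => ?_⟩
  by_contra hne
  have h := hle (((a - 1) / φ v) • v) (V.smul_mem _ hv)
  rw [map_smul, smul_eq_mul, div_mul_cancel₀ _ hne] at h
  linarith

/-- At a weak local minimizer with inactive constraints, the derivative of the objective takes
no value in the interior of the ordering cone. -/
theorem WeakLocalMin.fderiv_notMem_interior {s n m : ℕ}
    {C : Set (Fin n → ℝ)} {K : Set (Fin m → ℝ)} {X : Set (Fin s → ℝ)}
    {f : (Fin s → ℝ) → (Fin n → ℝ)} {g : (Fin s → ℝ) → (Fin m → ℝ)} {xbar : Fin s → ℝ}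
    (hmin : WeakLocalMin C K X f g xbar)
    (hC : ∀ c : ℝ, 0 ≤ c → ∀ x ∈ C, c • x ∈ C) (hX : X ∈ 𝓝 xbar)
    (hg : ContinuousAt g xbar) (hxfeas : g xbar ∈ -(interior K))
    {Df : (Fin s → ℝ) →L[ℝ] (Fin n → ℝ)} (hDf : HasFDerivAt f Df xbar) (u : Fin s → ℝ) :
    Df u ∉ interior C := by
  intro hu
  obtain ⟨N, hN, hmin⟩ := hmin
  have hfeas : ∀ᶠ x in 𝓝 xbar, g x ∈ -K :=
    (hg.eventually_mem (isOpen_interior.neg.mem_nhds hxfeas)).mono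
      fun x hx => interior_subset (s := K) hx
  have hline : Tendsto (fun t : ℝ => xbar + t • (-u)) (𝓝[>] 0) (𝓝 xbar) := by
    have h : Continuous fun t : ℝ => xbar + t • (-u) := by fun_prop
    simpa using (h.tendsto 0).mono_left nhdsWithin_le_nhds
  have hslope := (hDf.hasLineDerivAt (-u)).tendsto_slope_zero_right
  have hdir : ∀ᶠ t : ℝ in 𝓝[>] 0,
      t⁻¹ • (f (xbar + t • (-u)) - f xbar) ∈ -(interior C) :=
    hslope.eventually_mem (isOpen_interior.neg.mem_nhds (by simpa using hu))
  obtain ⟨t, hd, ht, ⟨htN, htX⟩, htK⟩ :=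
    (hdir.and (eventually_mem_nhdsWithin.and
      ((hline.eventually_mem (inter_mem hN hX)).and (hline.eventually hfeas)))).exists
  have ht : (0 : ℝ) < t := ht
  refine hmin _ htN htX htK ?_
  have h := smul_mem_interior_of_smul_mem hC ht hd
  rw [smul_neg, smul_inv_smul₀ ht.ne'] at h
  exact Set.mem_sub.2 ⟨_, rfl, _, h, by simp⟩

/-- If `x̄` is a weak local minimizer of (P), `f`, `g` are Fréchet differentiable at
`x̄`, `K` has nonempty interior and `g(x̄) ∈ −int K`, then there are Fritz John
multipliers with `μ = 0`: some `λ ∈ C*`, `λ ≠ 0`, with `λ·∇f(x̄) = 0`. -/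
theorem stmt_6 {s n m : ℕ}
    (C : Set (Fin n → ℝ)) (K : Set (Fin m → ℝ))
    (hC : IsClosedConvexPointedCone C) (hK : IsClosedConvexPointedCone K)
    (hCint : (interior C).Nonempty) (hKint : (interior K).Nonempty)
    (X : Set (Fin s → ℝ)) (hX : IsOpen X)
    (f : (Fin s → ℝ) → (Fin n → ℝ)) (g : (Fin s → ℝ) → (Fin m → ℝ))
    (xbar : Fin s → ℝ) (hxX : xbar ∈ X) (hxfeas : g xbar ∈ -(interior K))
    (hmin : WeakLocalMin C K X f g xbar)
    (Df : (Fin s → ℝ) →L[ℝ] (Fin n → ℝ)) (hDf : HasFDerivAt f Df xbar)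
    (Dg : (Fin s → ℝ) →L[ℝ] (Fin m → ℝ)) (hDg : HasFDerivAt g Dg xbar) :
    ∃ lam : Fin n → ℝ, lam ∈ polarCone C ∧ lam ≠ 0 ∧
      ∀ u : Fin s → ℝ, dotp lam (Df u) = 0 := by
  obtain ⟨-, hconv, -, hcone, -⟩ := hC
  have hdisj : Disjoint (interior C) (Df.range : Set (Fin n → ℝ)) := by
    rw [Set.disjoint_right]
    rintro _ ⟨u, rfl⟩
    exact hmin.fderiv_notMem_interior hcone (hX.mem_nhds hxX) hDg.continuousAt hxfeas hDf u
  obtain ⟨φ, hneg, hzero⟩ := exists_clm_neg_interior_of_disjoint hconv _ hdisj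
  obtain ⟨l, hl⟩ := exists_dotp_eq (-φ)
  refine ⟨l, fun x hx => ?_, ?_, fun u => ?_⟩
  · have hx : x ∈ closure (interior C) := by
      rw [hconv.closure_interior_eq_closure_of_nonempty_interior hCint]
      exact subset_closure hx
    have hsub : closure (interior C) ⊆ {y | φ y ≤ 0} :=
      closure_minimal (fun y hy => (hneg y hy).le) (isClosed_le φ.continuous continuous_const)
    have := hsub hx
    simpa [hl] using this
  · rintro rfl
    obtain ⟨x, hx⟩ := hCint
    have h := hl x
    have := hneg x hx
    simp [dotp] at h
    linarith
  · simpa [hl] using hzero _ ⟨u, rfl⟩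
end
end
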